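/- Let S be an instance of CLH(3,2), let q be a qubit that is not separable for S, and let H₁, H₂, H₃ ∈ S be an operator crown on q: there are five pairwise distinct particles q, a₁, a₂, a₃, a₄ with A_{H₁} = {a₁, a₂, q}, A_{H₂} = {a₂, q, a₃}, and A_{H₃} = {a₃, q, a₄}. Then every operator H ∈ S that acts nontrivially on q also acts nontrivially on at least one of the particles a₁, a₂, a₃, a₄. (Claim 4.13: an operator crown on a nonseparable qubit acts as an operator trap.) -/

import Mathlib

open Matrix

/-- An operator on a system of `n` qubits acts trivially on qubit `i` if it is the identity
on `H_i` tensored with an operator on the remaining factors. -/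
def ActsTriviallyAt {n : ℕ}
    (M : Matrix (Fin n → Fin 2) (Fin n → Fin 2) ℂ) (i : Fin n) : Prop :=
  ∃ N : Matrix ({j : Fin n // j ≠ i} → Fin 2) ({j : Fin n // j ≠ i} → Fin 2) ℂ,
    ∀ x y, M x y = (if x i = y i then (1 : ℂ) else 0) * N (fun j => x j.1) (fun j => y j.1)

/-- The support of an operator: the set of qubits on which it acts nontrivially. -/
def supp {n : ℕ} (M : Matrix (Fin n → Fin 2) (Fin n → Fin 2) ℂ) : Set (Fin n) :=
  {i | ¬ ActsTriviallyAt M i}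

/-- The orthogonal projection onto `ℂv` at site `i`, tensored with the identity on all other
qubits. -/
def projAt {n : ℕ} (i : Fin n) (v : Fin 2 → ℂ) :
    Matrix (Fin n → Fin 2) (Fin n → Fin 2) ℂ :=
  Matrix.of fun x y =>
    if Function.update x i (y i) = y then v (x i) * star (v (y i)) else 0

/-- A qubit `q` is separable for `S` if there is an orthonormal basis `{v₀, v₁}` of `H_q`
such that every element of `S` commutes with the projection onto `ℂv₀` at site `q`. -/
def SeparableAt {n : ℕ}
    (S : Finset (Matrix (Fin n → Fin 2) (Fin n → Fin 2) ℂ)) (q : Fin n) : Prop :=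
  ∃ v₀ v₁ : Fin 2 → ℂ,
    star v₀ ⬝ᵥ v₀ = 1 ∧ star v₁ ⬝ᵥ v₁ = 1 ∧ star v₀ ⬝ᵥ v₁ = 0 ∧
    ∀ H ∈ S, Commute H (projAt q v₀)

/-- An instance of `CLH(3,2)`: a finite set of pairwise commuting orthogonal projections on
`n` qubits, each with support of size at most 3. -/
def IsCLH32 {n : ℕ} (S : Finset (Matrix (Fin n → Fin 2) (Fin n → Fin 2) ℂ)) : Prop :=
  (∀ H ∈ S, H.IsHermitian ∧ H * H = H) ∧
  (∀ H ∈ S, ∀ H' ∈ S, Commute H H') ∧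
  (∀ H ∈ S, (supp H).ncard ≤ 3)

/-- The interaction graph of `S`: qubits are adjacent when some operator of `S` acts
nontrivially on both. -/
def interactionGraph {n : ℕ}
    (S : Finset (Matrix (Fin n → Fin 2) (Fin n → Fin 2) ℂ)) : SimpleGraph (Fin n) :=
  SimpleGraph.fromRel (fun i j => ∃ H ∈ S, i ∈ supp H ∧ j ∈ supp H)

/-- An open operator path of length `L` in `S`. -/
def IsOpenOpPath {n : ℕ} (S : Finset (Matrix (Fin n → Fin 2) (Fin n → Fin 2) ℂ))
    {L : ℕ} (P : Fin L → Matrix (Fin n → Fin 2) (Fin n → Fin 2) ℂ) : Prop :=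
  Function.Injective P ∧ (∀ i, P i ∈ S) ∧
  ∀ i k : Fin L,
    (Nat.dist i.1 k.1 = 1 → (supp (P i) ∩ supp (P k)).ncard = 2) ∧
    (Nat.dist i.1 k.1 = 2 → (supp (P i) ∩ supp (P k)).ncard = 1) ∧
    (2 < Nat.dist i.1 k.1 → supp (P i) ∩ supp (P k) = ∅)

/-- The operator on qubit `q` obtained from `M` by fixing the row and column indices of all
other qubits to those of `x` and `y`. -/
def siteSlice {n : ℕ} (q : Fin n) (M : Matrix (Fin n → Fin 2) (Fin n → Fin 2) ℂ)
    (x y : Fin n → Fin 2) : Matrix (Fin 2) (Fin 2) ℂ :=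
  Matrix.of fun s t => M (Function.update x q s) (Function.update y q t)

section Qubit

/-- Commutation of `2 × 2` matrices is transitive through a nonscalar matrix. -/
theorem commute_trans_of_nonscalar {B D E : Matrix (Fin 2) (Fin 2) ℂ}
    (hD : ∀ c : ℂ, D ≠ c • 1) (hBD : Commute B D) (hDE : Commute D E) : Commute B E := by
  have hD' : ¬ (D 0 1 = 0 ∧ D 1 0 = 0 ∧ D 0 0 = D 1 1) := by
    rintro ⟨h₁, h₂, h₃⟩
    apply hD (D 1 1)
    ext i j
    fin_cases i <;> fin_cases j <;> simp [h₁, h₂, h₃]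
  have e₁ := fun i j => congrFun (congrFun hBD.eq i) j
  have e₂ := fun i j => congrFun (congrFun hDE.eq i) j
  simp only [Matrix.mul_apply, Fin.sum_univ_two] at e₁ e₂
  have p₁ := e₁ 0 0
  have p₂ := e₁ 0 1
  have p₃ := e₁ 1 0
  have r₁ := e₂ 0 0
  have r₂ := e₂ 0 1
  have r₃ := e₂ 1 0
  have c₁ : B 0 1 * E 1 0 = B 1 0 * E 0 1 := by grind
  have c₂ : B 0 1 * (E 0 0 - E 1 1) = E 0 1 * (B 0 0 - B 1 1) := by grind
  have c₃ : B 1 0 * (E 0 0 - E 1 1) = E 1 0 * (B 0 0 - B 1 1) := by grind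
  refine Matrix.ext fun i j => ?_
  simp only [Matrix.mul_apply, Fin.sum_univ_two]
  fin_cases i <;> fin_cases j <;> simp <;> grind

/-- A nonscalar Hermitian `2 × 2` matrix has an eigenbasis whose first projection commutes with
everything that commutes with the matrix. -/
theorem exists_orthonormal_of_isHermitian {Z : Matrix (Fin 2) (Fin 2) ℂ} (hZ : Z.IsHermitian)
    (hns : ∀ c : ℂ, Z ≠ c • 1) :
    ∃ v₀ v₁ : Fin 2 → ℂ, star v₀ ⬝ᵥ v₀ = 1 ∧ star v₁ ⬝ᵥ v₁ = 1 ∧ star v₀ ⬝ᵥ v₁ = 0 ∧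
      ∀ E, Commute E Z → Commute E (Matrix.vecMulVec v₀ (star v₀)) := by
  let U : Matrix (Fin 2) (Fin 2) ℂ := hZ.eigenvectorUnitary
  have hU : star U * U = 1 := Unitary.coe_star_mul_self hZ.eigenvectorUnitary
  have hU' : U * star U = 1 := Unitary.coe_mul_star_self hZ.eigenvectorUnitary
  have hspec : Z = U * Matrix.diagonal (fun i => (hZ.eigenvalues i : ℂ)) * star U := by
    have h := hZ.spectral_theorem
    rw [Unitary.conjStarAlgAut_apply] at h
    exact h
  have horth : ∀ i j, star (fun k => U k i) ⬝ᵥ (fun k => U k j) = (1 : Matrix _ _ ℂ) i j := by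
    intro i j
    rw [← hU]
    rfl
  have hdecomp : Z = (hZ.eigenvalues 1 : ℂ) • 1 + ((hZ.eigenvalues 0 : ℂ) - hZ.eigenvalues 1) •
      Matrix.vecMulVec (fun k => U k 0) (star fun k => U k 0) := by
    rw [← hU']
    nth_rewrite 1 [hspec]
    ext i j
    simp [Matrix.mul_apply, Fin.sum_univ_two, Matrix.vecMulVec_apply, Matrix.diagonal]
    ring
  have hne : ((hZ.eigenvalues 0 : ℂ) - hZ.eigenvalues 1) ≠ 0 := by
    intro h
    rw [h, zero_smul, add_zero] at hdecomp
    exact hns _ hdecomp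
  refine ⟨fun k => U k 0, fun k => U k 1, ?_, ?_, ?_, fun E hE => ?_⟩
  · simpa using horth 0 0
  · simpa using horth 1 1
  · simpa using horth 0 1
  · have hP : Matrix.vecMulVec (fun k => U k 0) (star fun k => U k 0) =
        ((hZ.eigenvalues 0 : ℂ) - hZ.eigenvalues 1)⁻¹ • (Z - (hZ.eigenvalues 1 : ℂ) • 1) := by
      rw [eq_inv_smul_iff₀ hne, eq_sub_iff_add_eq, add_comm]
      exact hdecomp.symm
    rw [hP]
    exact (hE.sub_right ((Commute.one_right E).smul_right _)).smul_right _

/-- A nonscalar normal `2 × 2` matrix has an eigenbasis whose first projection commutes with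
everything that commutes with the matrix. -/
theorem exists_orthonormal_of_normal {B : Matrix (Fin 2) (Fin 2) ℂ} (hB : Commute B Bᴴ)
    (hns : ∀ c : ℂ, B ≠ c • 1) :
    ∃ v₀ v₁ : Fin 2 → ℂ, star v₀ ⬝ᵥ v₀ = 1 ∧ star v₁ ⬝ᵥ v₁ = 1 ∧ star v₀ ⬝ᵥ v₁ = 0 ∧
      ∀ E, Commute E B → Commute E (Matrix.vecMulVec v₀ (star v₀)) := by
  have hcomm : ∀ E, Commute E B → Commute E Bᴴ := fun E hE =>
    commute_trans_of_nonscalar hns hE hB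
  by_cases hsum : ∀ c : ℂ, B + Bᴴ ≠ c • 1
  · obtain ⟨v₀, v₁, h₀, h₁, h₀₁, h⟩ :=
      exists_orthonormal_of_isHermitian (Matrix.isHermitian_add_transpose_self B) hsum
    exact ⟨v₀, v₁, h₀, h₁, h₀₁, fun E hE => h E (hE.add_right (hcomm E hE))⟩
  · push Not at hsum
    obtain ⟨c, hc⟩ := hsum
    have hherm : (Complex.I • (B - Bᴴ)).IsHermitian := by
      rw [Matrix.IsHermitian, Matrix.conjTranspose_smul, Matrix.conjTranspose_sub,
        Matrix.conjTranspose_conjTranspose, ← neg_sub B, smul_neg, ← neg_smul]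
      simp
    have hdiff : ∀ d : ℂ, Complex.I • (B - Bᴴ) ≠ d • 1 := by
      intro d hd
      apply hns (2⁻¹ * (c - Complex.I * d))
      have hB2 : (2 : ℂ) • B = (B + Bᴴ) - Complex.I • (Complex.I • (B - Bᴴ)) := by
        rw [smul_smul, Complex.I_mul_I, neg_one_smul, two_smul]
        abel
      rw [mul_smul, eq_inv_smul_iff₀ two_ne_zero, hB2, hc, hd, smul_smul, sub_smul]
    obtain ⟨v₀, v₁, h₀, h₁, h₀₁, h⟩ := exists_orthonormal_of_isHermitian hherm hdiff
    exact ⟨v₀, v₁, h₀, h₁, h₀₁,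
      fun E hE => h E ((hE.sub_right (hcomm E hE)).smul_right _)⟩

end Qubit

section Support

variable {n : ℕ} {M N : Matrix (Fin n → Fin 2) (Fin n → Fin 2) ℂ} {q : Fin n}

theorem ActsTriviallyAt.apply_eq_zero {i : Fin n} (h : ActsTriviallyAt M i)
    {x y : Fin n → Fin 2} (hxy : x i ≠ y i) : M x y = 0 := by
  obtain ⟨N, hN⟩ := h
  simp [hN, hxy]

theorem ActsTriviallyAt.apply_update {i : Fin n} (h : ActsTriviallyAt M i)
    {x y : Fin n → Fin 2} (hxy : x i = y i) (s : Fin 2) :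
    M (Function.update x i s) (Function.update y i s) = M x y := by
  obtain ⟨N, hN⟩ := h
  rw [hN, hN x y]
  have hrest : ∀ z : Fin n → Fin 2,
      (fun j : {j : Fin n // j ≠ i} => Function.update z i s j.1) = fun j => z j.1 :=
    fun z => funext fun j => Function.update_of_ne j.2 _ _
  simp [hxy, hrest]

theorem apply_piecewise_of_actsTriviallyAt (F : Finset (Fin n))
    (hF : ∀ i ∈ F, ActsTriviallyAt M i) {x y x' y' : Fin n → Fin 2}
    (hxy : ∀ i ∈ F, x i = y i) (hxy' : ∀ i ∈ F, x' i = y' i) :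
    M (F.piecewise x' x) (F.piecewise y' y) = M x y := by
  induction F using Finset.induction_on with
  | empty => simp
  | insert i F hi ih =>
    rw [Finset.piecewise_insert, Finset.piecewise_insert, hxy' i (Finset.mem_insert_self i F),
      (hF i (Finset.mem_insert_self i F)).apply_update]
    · exact ih (fun j hj => hF j (Finset.mem_insert_of_mem hj))
        (fun j hj => hxy j (Finset.mem_insert_of_mem hj))
        (fun j hj => hxy' j (Finset.mem_insert_of_mem hj))
    · simp [Finset.piecewise_eq_of_notMem _ _ _ hi, hxy i (Finset.mem_insert_self i F)]

/-- An entry of `M` depends only on the indices in the support, as long as row and column agree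
off the support. -/
theorem apply_eq_of_eqOn_supp {x y x' y' : Fin n → Fin 2}
    (hx : ∀ i ∈ supp M, x i = x' i) (hy : ∀ i ∈ supp M, y i = y' i)
    (hxy : ∀ i ∉ supp M, x i = y i) (hxy' : ∀ i ∉ supp M, x' i = y' i) :
    M x y = M x' y' := by
  classical
  let F : Finset (Fin n) := Finset.univ.filter fun i => i ∉ supp M
  have hmem : ∀ i, i ∈ F ↔ i ∉ supp M := fun i => by simp [F]
  have h := apply_piecewise_of_actsTriviallyAt (M := M) F
    (fun i hi => not_not.mp ((hmem i).mp hi)) (x := x') (y := y') (x' := x) (y' := y)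
    (fun i hi => hxy' i ((hmem i).mp hi)) (fun i hi => hxy i ((hmem i).mp hi))
  rw [← h]
  congr 1 <;> funext i <;> by_cases hi : i ∈ supp M <;> simp [Finset.piecewise, hmem, hi, hx, hy]

theorem apply_eq_zero_of_ne {i : Fin n} (hi : i ∉ supp M) {x y : Fin n → Fin 2}
    (hxy : x i ≠ y i) : M x y = 0 :=
  (not_not.mp hi : ActsTriviallyAt M i).apply_eq_zero hxy

theorem siteSlice_eq_zero {i : Fin n} (hi : i ∉ supp M) (hiq : i ≠ q) {x y : Fin n → Fin 2}
    (hxy : x i ≠ y i) : siteSlice q M x y = 0 := by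
  ext s t
  exact apply_eq_zero_of_ne hi (by simpa [hiq] using hxy)

/-- If the supports of `M` and `N` meet only in `q`, then the entries of `M * N` are, at indices
`u`, `w` merging those of the slices, the entries of the product of slices at `q`. -/
theorem mul_apply_eq_siteSlice_mul (hqM : q ∈ supp M) (hqN : q ∈ supp N)
    (hMN : ∀ i ∈ supp M, i ∈ supp N → i = q) {x y x' y' u w : Fin n → Fin 2}
    (hxy : ∀ i ∉ supp M, x i = y i) (hxy' : ∀ i ∉ supp N, x' i = y' i)
    (huM : ∀ i ∈ supp M, i ≠ q → u i = x i) (hwM : ∀ i ∈ supp M, i ≠ q → w i = y i)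
    (huN : ∀ i ∈ supp N, i ≠ q → u i = x' i) (hwN : ∀ i ∈ supp N, i ≠ q → w i = y' i)
    (huw : ∀ i ∉ supp M, i ∉ supp N → u i = w i) (s t : Fin 2) :
    (M * N) (Function.update u q s) (Function.update w q t) =
      (siteSlice q M x y * siteSlice q N x' y') s t := by
  classical
  let z₀ : Fin n → Fin 2 := fun i => if i ∈ supp M then w i else u i
  have hz₀M : ∀ i ∈ supp M, z₀ i = w i := fun i hi => if_pos hi
  have hz₀M' : ∀ i ∉ supp M, z₀ i = u i := fun i hi => if_neg hi
  rw [Matrix.mul_apply, Matrix.mul_apply]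
  symm
  apply Fintype.sum_of_injective (fun r : Fin 2 => Function.update z₀ q r)
    (Function.update_injective z₀ q)
  · intro z hz
    by_contra hne
    apply hz
    refine ⟨z q, funext fun i => ?_⟩
    by_cases hiq : i = q
    · subst hiq; simp
    by_cases hi : i ∈ supp M
    · have hiN : i ∉ supp N := fun h => hiq (hMN i hi h)
      have hzw := mt (apply_eq_zero_of_ne hiN) (right_ne_zero_of_mul hne)
      simpa [hiq, hz₀M i hi] using (not_not.mp hzw).symm
    · have huz := mt (apply_eq_zero_of_ne hi) (left_ne_zero_of_mul hne)
      simpa [hiq, hz₀M' i hi] using not_not.mp huz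
  · intro r
    refine congrArg₂ (· * ·) ?_ ?_
    · apply apply_eq_of_eqOn_supp <;> intro i hi <;> by_cases hiq : i = q
      all_goals first | (subst hiq; first | contradiction | simp) | simp only [ne_eq, hiq,
        not_false_eq_true, Function.update_of_ne]
      · exact (huM i hi hiq).symm
      · rw [hz₀M i hi, hwM i hi hiq]
      · exact hxy i hi
      · exact (hz₀M' i hi).symm
    · apply apply_eq_of_eqOn_supp <;> intro i hi <;> by_cases hiq : i = q
      all_goals first | (subst hiq; first | contradiction | simp) | simp only [ne_eq, hiq,
        not_false_eq_true, Function.update_of_ne]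
      · rw [hz₀M' i fun h => hiq (hMN i h hi), huN i hi hiq]
      · exact (hwN i hi hiq).symm
      · exact hxy' i hi
      · by_cases hiM : i ∈ supp M
        · exact hz₀M i hiM
        · rw [hz₀M' i hiM, huw i hiM hi]

/-- If commuting operators have supports meeting only in `q`, then their slices at `q`
commute. -/
theorem commute_siteSlice (hcomm : Commute M N) (hqM : q ∈ supp M) (hqN : q ∈ supp N)
    (hMN : ∀ i ∈ supp M, i ∈ supp N → i = q) (x y x' y' : Fin n → Fin 2) :
    Commute (siteSlice q M x y) (siteSlice q N x' y') := by
  classical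
  by_cases hxy : ∀ i ∉ supp M, x i = y i
  swap
  · push Not at hxy
    obtain ⟨i, hi, hne⟩ := hxy
    rw [siteSlice_eq_zero hi (fun h => hi (h ▸ hqM)) hne]
    exact Commute.zero_left _
  by_cases hxy' : ∀ i ∉ supp N, x' i = y' i
  swap
  · push Not at hxy'
    obtain ⟨i, hi, hne⟩ := hxy'
    rw [siteSlice_eq_zero hi (fun h => hi (h ▸ hqN)) hne]
    exact Commute.zero_right _
  let u : Fin n → Fin 2 := fun i => if i ∈ supp M then x i else x' i
  let w : Fin n → Fin 2 := fun i => if i ∈ supp M then y i else y' i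
  have huM : ∀ i ∈ supp M, i ≠ q → u i = x i := fun i hi _ => if_pos hi
  have hwM : ∀ i ∈ supp M, i ≠ q → w i = y i := fun i hi _ => if_pos hi
  have huN : ∀ i ∈ supp N, i ≠ q → u i = x' i := fun i hi hiq => if_neg fun h => hiq (hMN i h hi)
  have hwN : ∀ i ∈ supp N, i ≠ q → w i = y' i := fun i hi hiq => if_neg fun h => hiq (hMN i h hi)
  have huw : ∀ i ∉ supp M, i ∉ supp N → u i = w i := fun i hM hN => by
    simp only [u, w, if_neg hM, hxy' i hN]
  refine Matrix.ext fun s t => ?_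
  rw [← mul_apply_eq_siteSlice_mul hqM hqN hMN hxy hxy' huM hwM huN hwN huw,
    ← mul_apply_eq_siteSlice_mul hqN hqM (fun i hN hM => hMN i hM hN) hxy' hxy huN hwN huM hwM
      (fun i hN hM => huw i hM hN), hcomm.eq]

/-- An operator acts trivially on `q` exactly when all its slices at `q` are scalar. -/
theorem notMem_supp_iff_siteSlice_scalar :
    q ∉ supp M ↔ ∀ x y, ∃ c : ℂ, siteSlice q M x y = c • 1 := by
  constructor
  · intro hq x y
    obtain ⟨N, hN⟩ := not_not.mp hq
    refine ⟨N (fun j => x j.1) (fun j => y j.1), ?_⟩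
    ext s t
    have hrest : ∀ (z : Fin n → Fin 2) (r : Fin 2),
        (fun j : {j : Fin n // j ≠ q} => Function.update z q r j.1) = fun j => z j.1 :=
      fun z r => funext fun j => Function.update_of_ne j.2 _ _
    simp [siteSlice, hN, hrest, Matrix.one_apply]
  · intro h
    refine not_not.mpr ⟨fun x' y' => M (fun j => if hj : j = q then 0 else x' ⟨j, hj⟩)
      (fun j => if hj : j = q then 0 else y' ⟨j, hj⟩), fun x y => ?_⟩
    obtain ⟨c, hc⟩ := h x y
    have hentry : ∀ s t, M (Function.update x q s) (Function.update y q t) =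
        if s = t then c else 0 := fun s t => by
      have := congrFun (congrFun hc s) t
      simpa [siteSlice, Matrix.one_apply] using this
    have hzero : ∀ z : Fin n → Fin 2,
        (fun j => if j = q then 0 else z j) = Function.update z q 0 := fun z => by
      funext j
      by_cases hj : j = q
      · subst hj; simp
      · simp [hj]
    have hdiag := hentry (x q) (y q)
    rw [Function.update_eq_self, Function.update_eq_self] at hdiag
    simp [hzero, hentry, hdiag]

/-- If the projection onto `ℂv` commutes with all slices of `M` at `q`, then its extension to the
full system commutes with `M`. -/
theorem commute_projAt {v : Fin 2 → ℂ}
    (h : ∀ x y, Commute (siteSlice q M x y) (Matrix.vecMulVec v (star v))) :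
    Commute M (projAt q v) := by
  refine Matrix.ext fun x y => ?_
  have hslice := congrFun (congrFun (h x y).eq (x q)) (y q)
  rw [Matrix.mul_apply, Matrix.mul_apply] at hslice ⊢
  convert hslice using 1
  · symm
    apply Fintype.sum_of_injective (fun r : Fin 2 => Function.update y q r)
      (Function.update_injective y q)
    · intro z hz
      have hzy : Function.update z q (y q) ≠ y := fun hzy =>
        hz ⟨z q, by
          change Function.update y q (z q) = z
          rw [← hzy]
          simp⟩
      simp [projAt, hzy]
    · intro r
      simp [projAt, siteSlice, Matrix.vecMulVec_apply]
  · symm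
    apply Fintype.sum_of_injective (fun r : Fin 2 => Function.update x q r)
      (Function.update_injective x q)
    · intro z hz
      have hxz : Function.update x q (z q) ≠ z := fun hxz => hz ⟨z q, hxz⟩
      simp [projAt, hxz]
    · intro r
      simp [projAt, siteSlice, Matrix.vecMulVec_apply]

theorem conjTranspose_siteSlice (hM : M.IsHermitian) (x y : Fin n → Fin 2) :
    (siteSlice q M x y)ᴴ = siteSlice q M y x := by
  ext s t
  exact hM.apply _ _

end Support

/-- Claim 4.13.  Let `S` be an instance of `CLH(3,2)`, `q` a qubit that is
not separable for `S`, and `H₁, H₂, H₃ ∈ S` an operator crown on `q`: their supports are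
`{a₁,a₂,q}`, `{a₂,q,a₃}`, `{a₃,q,a₄}` for five pairwise distinct particles `q,a₁,a₂,a₃,a₄`.
Then every `H ∈ S` acting nontrivially on `q` also acts nontrivially on one of
`a₁, a₂, a₃, a₄`. -/
theorem operator_crown_is_operator_trap
    {n : ℕ} (S : Finset (Matrix (Fin n → Fin 2) (Fin n → Fin 2) ℂ))
    (hclh : IsCLH32 S)
    (q a₁ a₂ a₃ a₄ : Fin n)
    (hdistinct : ({q, a₁, a₂, a₃, a₄} : Finset (Fin n)).card = 5)
    (hqnosep : ¬ SeparableAt S q)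
    (H₁ H₂ H₃ : Matrix (Fin n → Fin 2) (Fin n → Fin 2) ℂ)
    (hH₁ : H₁ ∈ S) (hH₂ : H₂ ∈ S) (hH₃ : H₃ ∈ S)
    (hs₁ : supp H₁ = {a₁, a₂, q}) (hs₂ : supp H₂ = {a₂, q, a₃}) (hs₃ : supp H₃ = {a₃, q, a₄}) :
    ∀ H ∈ S, q ∈ supp H →
      (a₁ ∈ supp H ∨ a₂ ∈ supp H ∨ a₃ ∈ supp H ∨ a₄ ∈ supp H) := by
  obtain ⟨hproj, hcomm, hcard⟩ := hclh
  intro H hH hqH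
  by_contra hcon
  push Not at hcon
  obtain ⟨h₁, h₂, h₃, h₄⟩ := hcon
  apply hqnosep
  obtain ⟨x₀, y₀, hB⟩ : ∃ x y, ∀ c : ℂ, siteSlice q H x y ≠ c • 1 := by
    by_contra hall
    push Not at hall
    exact notMem_supp_iff_siteSlice_scalar.mpr hall hqH
  have hmeet₁ : ∀ i ∈ supp H, i ∈ supp H₁ → i = q := by
    intro i hi hi'
    rw [hs₁] at hi'
    rcases hi' with rfl | rfl | rfl <;> first | contradiction | rfl
  have hmeet₃ : ∀ i ∈ supp H, i ∈ supp H₃ → i = q := by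
    intro i hi hi'
    rw [hs₃] at hi'
    rcases hi' with rfl | rfl | rfl <;> first | contradiction | rfl
  have hrelay : ∀ K ∈ S, q ∈ supp K → (∀ i ∈ supp H, i ∈ supp K → i = q) →
      ∀ H' ∈ S, q ∈ supp H' → (∀ i ∈ supp H', i ∈ supp K → i = q) →
      ∀ x y, Commute (siteSlice q H' x y) (siteSlice q H x₀ y₀) := by
    intro K hK hqK hHK H' hH' hqH' hH'K x y
    obtain ⟨x₁, y₁, hD⟩ : ∃ x y, ∀ c : ℂ, siteSlice q K x y ≠ c • 1 := by
      by_contra hall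
      push Not at hall
      exact notMem_supp_iff_siteSlice_scalar.mpr hall hqK
    exact commute_trans_of_nonscalar hD
      (commute_siteSlice (hcomm H' hH' K hK) hqH' hqK hH'K x y x₁ y₁)
      (commute_siteSlice (hcomm H hH K hK) hqH hqK hHK x₀ y₀ x₁ y₁).symm
  have hqH₁ : q ∈ supp H₁ := by simp [hs₁]
  have hqH₃ : q ∈ supp H₃ := by simp [hs₃]
  have hall : ∀ H' ∈ S, ∀ x y, Commute (siteSlice q H' x y) (siteSlice q H x₀ y₀) := by
    intro H' hH' x y
    by_cases hqH' : q ∈ supp H'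
    swap
    · obtain ⟨c, hc⟩ := notMem_supp_iff_siteSlice_scalar.mp hqH' x y
      rw [hc]
      exact (Commute.one_left _).smul_left c
    by_cases hm : ∀ i ∈ supp H', i ∈ supp H → i = q
    · exact commute_siteSlice (hcomm H' hH' H hH) hqH' hqH hm x y x₀ y₀
    by_cases hm₁ : ∀ i ∈ supp H', i ∈ supp H₁ → i = q
    · exact hrelay H₁ hH₁ hqH₁ hmeet₁ H' hH' hqH' hm₁ x y
    by_cases hm₃ : ∀ i ∈ supp H', i ∈ supp H₃ → i = q
    · exact hrelay H₃ hH₃ hqH₃ hmeet₃ H' hH' hqH' hm₃ x y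
    exfalso
    push Not at hm hm₁ hm₃
    obtain ⟨b, hb, hbH, hbq⟩ := hm
    obtain ⟨c, hc, hcH₁, hcq⟩ := hm₁
    obtain ⟨d, hd, hdH₃, hdq⟩ := hm₃
    have hbc : b ≠ c := fun h => hbq (hmeet₁ b hbH (h ▸ hcH₁))
    have hbd : b ≠ d := fun h => hbq (hmeet₃ b hbH (h ▸ hdH₃))
    have hcd : c ≠ d := by
      rintro rfl
      rw [hs₁] at hcH₁
      rw [hs₃] at hdH₃
      have hpair : a₁ ≠ a₃ ∧ a₁ ≠ a₄ ∧ a₂ ≠ a₃ ∧ a₂ ≠ a₄ := by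
        have hnodup : (↑[q, a₁, a₂, a₃, a₄] : Multiset (Fin n)).Nodup :=
          Multiset.toFinset_card_eq_card_iff_nodup.mp (by simpa using hdistinct)
        simp only [Multiset.coe_nodup, List.nodup_cons, List.mem_cons, not_or] at hnodup
        tauto
      obtain ⟨h₁₃, h₁₄, h₂₃, h₂₄⟩ := hpair
      rcases hcH₁ with h | h | h <;> rcases hdH₃ with h' | h' | h' <;>
        first
        | exact hcq h
        | exact hcq h'
        | exact absurd (h.symm.trans h') (by assumption)
    have hsub : ((({q, b, c, d} : Finset (Fin n)) : Set (Fin n))) ⊆ supp H' := by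
      intro i hi
      simp only [Finset.coe_insert, Finset.coe_singleton, Set.mem_insert_iff,
        Set.mem_singleton_iff] at hi
      rcases hi with rfl | rfl | rfl | rfl <;> assumption
    have hfour := Set.ncard_le_ncard hsub (Set.toFinite _)
    rw [Set.ncard_coe_finset, Finset.card_insert_of_notMem (by simp [hbq.symm, hcq.symm, hdq.symm]),
      Finset.card_insert_of_notMem (by simp [hbc, hbd]), Finset.card_pair hcd] at hfour
    have := hcard H' hH'
    omega
  have hnormal : Commute (siteSlice q H x₀ y₀) (siteSlice q H x₀ y₀)ᴴ := by
    rw [conjTranspose_siteSlice (hproj H hH).1]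
    exact (hall H hH y₀ x₀).symm
  obtain ⟨v₀, v₁, hv₀, hv₁, hv₀₁, hv⟩ := exists_orthonormal_of_normal hnormal hB
  exact ⟨v₀, v₁, hv₀, hv₁, hv₀₁,
    fun H' hH' => commute_projAt fun x y => hv _ (hall H' hH' x y)⟩
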